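/- Let Γ be an infinite group with finite symmetric generating set and word metric, and f a control function such that the fundamental class [Γ] vanishes in H_0^f(Γ). Suppose there is ε > 0 such that for every integer r ≥ 1 there exists a nonempty finite subset F_r ⊆ Γ with rad F_r ≤ r and #F_r ≥ ε·r·#∂F_r (i.e. the isodiametric profile of Γ grows at least linearly). Then there is c > 0 with f(r) ≥ c·r for all r ≥ 1; that is, f must grow at least linearly. -/

import Mathlib

/-- Word length of `γ` with respect to a generating set `S`. -/
noncomputable def wLen {Γ : Type*} [Group Γ] (S : Set Γ) (γ : Γ) : ℕ :=
  sInf {n | ∃ l : List Γ, (∀ s ∈ l, s ∈ S) ∧ l.length = n ∧ l.prod = γ}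

/-- The left-invariant word metric `d(x,y) = |x⁻¹y|`. -/
noncomputable def wDist {Γ : Type*} [Group Γ] (S : Set Γ) (x y : Γ) : ℕ :=
  wLen S (x⁻¹ * y)

/-- A control function: non-decreasing, nonnegative on `[0,∞)`, `f 0 = 1`, with
controlled behaviour under additive shifts and multiplicative rescalings. -/
structure IsControlFun (f : ℝ → ℝ) : Prop where
  nonneg : ∀ t : ℝ, 0 ≤ t → 0 ≤ f t
  mono : ∀ s t : ℝ, 0 ≤ s → s ≤ t → f s ≤ f t
  one_at_zero : f 0 = 1
  shift : ∀ K > (0:ℝ), ∃ L > (0:ℝ), ∀ t > (0:ℝ), f (t + K) ≤ L * f t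
  scale : ∀ K > (0:ℝ), ∃ L > (0:ℝ), ∀ t > (0:ℝ), f (K * t) ≤ L * f t

/-- An `f`-controlled 1-chain on a group with the word metric of `S`. -/
structure IsChainW {Γ : Type*} [Group Γ] (S : Set Γ) (f : ℝ → ℝ) (ψ : Γ → Γ → ℝ) : Prop where
  antisymm : ∀ x y, ψ x y = - ψ y x
  finprop : ∃ R > (0:ℝ), ∀ x y, R < (wDist S x y : ℝ) → ψ x y = 0
  bound : ∃ K > (0:ℝ), ∀ x y,
    |ψ x y| ≤ K * f (max (wLen S x : ℝ) (wLen S y : ℝ))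

/-- The boundary `∂A` with respect to the word metric of `S`. -/
def isoBdryW {Γ : Type*} [Group Γ] (S : Set Γ) (A : Set Γ) : Set Γ :=
  {x | (∃ a ∈ A, wDist S x a ≤ 1) ∧ (∃ b ∈ Aᶜ, wDist S x b ≤ 1)}

/-- The isoperimetric inequality `(I^f_∂)` for the word metric of `S`. -/
def SatIsoW {Γ : Type*} [Group Γ] (S : Set Γ) (f : ℝ → ℝ) : Prop :=
  ∃ C > (0:ℝ), ∀ A : Finset Γ,
    (A.card : ℝ) ≤ C * ∑ᶠ x ∈ isoBdryW S (A : Set Γ), f (wLen S x : ℝ)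

/-- The radius of a finite set: the least `r` such that `A` is contained in a closed
ball of radius `r`. -/
noncomputable def radW {Γ : Type*} [Group Γ] (S : Set Γ) (A : Finset Γ) : ℕ :=
  sInf {r : ℕ | ∃ g : Γ, ∀ x ∈ A, wDist S g x ≤ r}

open Classical in
/-- Summing the boundary of an antisymmetric chain over `A` leaves only the flow out of `A`. -/
lemma sum_finsum_eq_sum_finsum_notMem {X : Type*} {ψ : X → X → ℝ}
    (hanti : ∀ x y, ψ x y = -ψ y x)
    (hfin : ∀ x, (Function.support fun y => ψ y x).Finite) (A : Finset X) :
    ∑ x ∈ A, ∑ᶠ y, ψ y x = ∑ x ∈ A, ∑ᶠ y, if y ∈ A then 0 else ψ y x := by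
  have hsplit : ∀ x, ∑ᶠ y, ψ y x =
      ∑ y ∈ A, ψ y x + ∑ᶠ y, if y ∈ A then 0 else ψ y x := by
    intro x
    have hA : ∑ y ∈ A, ψ y x = ∑ᶠ y, if y ∈ A then ψ y x else 0 := by
      rw [finsum_eq_sum_of_support_subset (s := A)]
      · exact Finset.sum_congr rfl fun y hy => by simp [hy]
      · intro y hy
        by_contra h
        exact hy (if_neg h)
    rw [hA, ← finsum_add_distrib]
    · exact finsum_congr fun y => by split_ifs <;> simp
    · exact (hfin x).subset fun y hy h => hy (by simp only [h, ite_self])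
    · exact (hfin x).subset fun y hy h => hy (by simp only [h, ite_self])
  have hzero : ∑ x ∈ A, ∑ y ∈ A, ψ y x = 0 := by
    have h : ∑ x ∈ A, ∑ y ∈ A, ψ y x = -∑ x ∈ A, ∑ y ∈ A, ψ y x := by
      conv_lhs => rw [Finset.sum_comm]
      simp only [← Finset.sum_neg_distrib, ← hanti]
    linarith
  rw [Finset.sum_congr rfl fun x _ => hsplit x, Finset.sum_add_distrib, hzero, zero_add]

section WordLength

variable {Γ : Type*} [Group Γ] {S : Set Γ}

lemma wLen_le_of_list {l : List Γ} (hl : ∀ s ∈ l, s ∈ S) : wLen S l.prod ≤ l.length :=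
  Nat.sInf_le ⟨l, hl, rfl, rfl⟩

/-- The word length is attained by a word in a symmetric generating set. -/
lemma exists_list_length_eq_wLen (hsym : ∀ s ∈ S, s⁻¹ ∈ S)
    (hgen : Subgroup.closure S = ⊤) (γ : Γ) :
    ∃ l : List Γ, (∀ s ∈ l, s ∈ S) ∧ l.length = wLen S γ ∧ l.prod = γ := by
  have hγ : γ ∈ Submonoid.closure (S ∪ S⁻¹) := by
    rw [← Subgroup.closure_toSubmonoid, hgen]
    trivial
  obtain ⟨l, hl, rfl⟩ := Submonoid.exists_list_of_mem_closure hγ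
  have hlS : ∀ s ∈ l, s ∈ S := fun s hs =>
    (hl s hs).elim id fun h => inv_inv s ▸ hsym _ h
  exact Nat.sInf_mem
    (s := {n | ∃ l' : List Γ, (∀ s ∈ l', s ∈ S) ∧ l'.length = n ∧ l'.prod = l.prod})
    ⟨l.length, l, hlS, rfl, rfl⟩

lemma wLen_one : wLen S (1 : Γ) = 0 :=
  Nat.le_zero.mp (wLen_le_of_list (l := []) (by simp))

lemma wLen_le_one_of_mem {s : Γ} (hs : s ∈ S) : wLen S s ≤ 1 := by
  simpa using wLen_le_of_list (S := S) (l := [s]) (by simpa using hs)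

lemma wLen_mul_le (hsym : ∀ s ∈ S, s⁻¹ ∈ S) (hgen : Subgroup.closure S = ⊤) (a b : Γ) :
    wLen S (a * b) ≤ wLen S a + wLen S b := by
  obtain ⟨l, hl, hla, rfl⟩ := exists_list_length_eq_wLen hsym hgen a
  obtain ⟨m, hm, hmb, rfl⟩ := exists_list_length_eq_wLen hsym hgen b
  rw [← hla, ← hmb, ← List.prod_append, ← List.length_append]
  exact wLen_le_of_list fun s hs => (List.mem_append.mp hs).elim (hl s) (hm s)

lemma finite_wLen_le (hS : S.Finite) (hsym : ∀ s ∈ S, s⁻¹ ∈ S)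
    (hgen : Subgroup.closure S = ⊤) (n : ℕ) : {γ : Γ | wLen S γ ≤ n}.Finite := by
  have := hS.to_subtype
  refine ((List.finite_length_le S n).image
    fun l => (l.map Subtype.val).prod).subset fun γ hγ => ?_
  obtain ⟨l, hl, hlen, rfl⟩ := exists_list_length_eq_wLen hsym hgen γ
  lift l to List S using hl
  refine ⟨l, ?_, rfl⟩
  rw [List.length_map] at hlen
  exact hlen.trans_le hγ

lemma finite_isoBdryW (hS : S.Finite) (hsym : ∀ s ∈ S, s⁻¹ ∈ S)
    (hgen : Subgroup.closure S = ⊤) (A : Finset Γ) : (isoBdryW S (A : Set Γ)).Finite := by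
  refine (A.finite_toSet.image2 (fun a u => a * u⁻¹)
    (finite_wLen_le hS hsym hgen 1)).subset ?_
  rintro x ⟨⟨a, ha, hxa⟩, -⟩
  exact ⟨a, ha, x⁻¹ * a, hxa, by simp⟩

lemma exists_wDist_le_radW (A : Finset Γ) : ∃ g : Γ, ∀ x ∈ A, wDist S g x ≤ radW S A :=
  Nat.sInf_mem (s := {r : ℕ | ∃ g : Γ, ∀ x ∈ A, wDist S g x ≤ r})
    ⟨A.sup (wDist S 1), 1, fun _ hx => Finset.le_sup hx⟩

open Classical in
/-- Right translation by a word of length `n` moves at most `n * #∂A` points out of `A`. -/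
lemma card_filter_mul_notMem_le_of_list (A : Finset Γ)
    (hfin : (isoBdryW S (A : Set Γ)).Finite) (l : List Γ) (hl : ∀ s ∈ l, s ∈ S) :
    (A.filter fun x => x * l.prod ∉ A).card ≤
      l.length * (isoBdryW S (A : Set Γ)).ncard := by
  induction l with
  | nil => simp
  | cons s l ih =>
    have hs : s ∈ S := hl s (by simp)
    have hsub : (A.filter fun x => x * (s :: l).prod ∉ A) ⊆
        hfin.toFinset ∪ (A.filter fun x => x * l.prod ∉ A).image (· * s⁻¹) := by
      intro x hx
      rw [Finset.mem_filter, List.prod_cons, ← mul_assoc] at hx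
      rw [Finset.mem_union, Set.Finite.mem_toFinset, Finset.mem_image]
      by_cases hxs : x * s ∈ A
      · exact Or.inr ⟨x * s, Finset.mem_filter.mpr ⟨hxs, hx.2⟩, by simp⟩
      · refine Or.inl ⟨⟨x, hx.1, ?_⟩, x * s, by simpa using hxs, ?_⟩
        · simp [wDist, wLen_one]
        · simpa [wDist] using wLen_le_one_of_mem hs
    calc _ ≤ _ := Finset.card_le_card hsub
      _ ≤ _ := Finset.card_union_le _ _
      _ ≤ (isoBdryW S (A : Set Γ)).ncard + l.length * (isoBdryW S (A : Set Γ)).ncard := by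
        rw [Set.ncard_eq_toFinset_card _ hfin]
        rw [Set.ncard_eq_toFinset_card _ hfin] at ih
        exact Nat.add_le_add_left
          (Finset.card_image_le.trans (ih fun t ht => hl t (by simp [ht]))) _
      _ = _ := by rw [List.length_cons]; ring

open Classical in
lemma card_filter_mul_notMem_le (hsym : ∀ s ∈ S, s⁻¹ ∈ S) (hgen : Subgroup.closure S = ⊤)
    (A : Finset Γ) (hfin : (isoBdryW S (A : Set Γ)).Finite) (b : Γ) :
    (A.filter fun x => x * b ∉ A).card ≤ wLen S b * (isoBdryW S (A : Set Γ)).ncard := by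
  obtain ⟨l, hl, hlen, rfl⟩ := exists_list_length_eq_wLen hsym hgen b
  exact hlen ▸ card_filter_mul_notMem_le_of_list A hfin l hl

/-- A set filled by an antisymmetric chain of propagation `N` bounded by `M` on `A` satisfies an
isoperimetric inequality. -/
lemma card_le_of_chain (hS : S.Finite) (hsym : ∀ s ∈ S, s⁻¹ ∈ S)
    (hgen : Subgroup.closure S = ⊤) {ψ : Γ → Γ → ℝ} (hanti : ∀ x y, ψ x y = -ψ y x) {N : ℕ}
    (hprop : ∀ x y, N < wDist S x y → ψ x y = 0) (hone : ∀ x, ∑ᶠ y, ψ y x = 1)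
    (A : Finset Γ) {M : ℝ} (hM : 0 ≤ M)
    (hbound : ∀ x ∈ A, ∀ y, wDist S x y ≤ N → |ψ x y| ≤ M) :
    (A.card : ℝ) ≤
      {b : Γ | wLen S b ≤ N}.ncard * N * M * (isoBdryW S (A : Set Γ)).ncard := by
  classical
  have hball := finite_wLen_le hS hsym hgen N
  set B := hball.toFinset with hB
  have hmemB : ∀ b, b ∈ B ↔ wLen S b ≤ N := fun b => by simp [hB]
  have hzero : ∀ x b, b ∉ B → ψ (x * b) x = 0 := by
    intro x b hb
    rw [hanti, hprop, neg_zero]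
    simpa [wDist, hmemB] using hb
  have hsupp : ∀ x, (Function.support fun y => ψ y x).Finite := by
    intro x
    refine (B.finite_toSet.image (x * ·)).subset fun y hy => ⟨x⁻¹ * y, ?_, by simp⟩
    by_contra h
    exact hy (by simpa using hzero x _ h)
  have hterm : ∀ x ∈ A, (∑ᶠ y, if y ∈ A then 0 else ψ y x) ≤
      ∑ b ∈ B, if x * b ∉ A then M else 0 := by
    intro x hx
    rw [← finsum_comp_equiv (Equiv.mulLeft x), finsum_eq_sum_of_support_subset (s := B)]
    · refine Finset.sum_le_sum fun b hb => ?_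
      rw [Equiv.coe_mulLeft, ite_not]
      by_cases hxb : x * b ∈ A
      · rw [if_pos hxb, if_pos hxb]
      · rw [if_neg hxb, if_neg hxb, hanti]
        refine (neg_le_abs _).trans (hbound x hx _ ?_)
        simpa [wDist] using (hmemB b).mp hb
    · intro b hb
      by_contra h
      exact hb (by simp [hzero x b h])
  calc (A.card : ℝ) = ∑ x ∈ A, ∑ᶠ y, ψ y x := by simp [hone]
    _ = ∑ x ∈ A, ∑ᶠ y, if y ∈ A then 0 else ψ y x :=
      sum_finsum_eq_sum_finsum_notMem hanti hsupp A
    _ ≤ ∑ x ∈ A, ∑ b ∈ B, if x * b ∉ A then M else 0 := Finset.sum_le_sum hterm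
    _ = ∑ b ∈ B, (A.filter fun x => x * b ∉ A).card * M := by
      rw [Finset.sum_comm]
      exact Finset.sum_congr rfl fun b _ => by
        rw [← Finset.sum_filter, Finset.sum_const, nsmul_eq_mul]
    _ ≤ ∑ _b ∈ B, (N * (isoBdryW S (A : Set Γ)).ncard : ℝ) * M := by
      refine Finset.sum_le_sum fun b hb => mul_le_mul_of_nonneg_right ?_ hM
      have h := card_filter_mul_notMem_le hsym hgen A (finite_isoBdryW hS hsym hgen A) b
      exact_mod_cast h.trans (Nat.mul_le_mul_right _ ((hmemB b).mp hb))
    _ = _ := by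
      rw [Finset.sum_const, nsmul_eq_mul, Set.ncard_eq_toFinset_card _ hball]
      ring

end WordLength

/-- If the fundamental class of an infinite finitely generated
group vanishes in `H_0^f(Γ)` and the isodiametric profile grows at least
linearly, then `f` grows at least linearly. -/
theorem control_at_least_linear_of_linear_isodiametric_profile
    {Γ : Type*} [Group Γ] [Infinite Γ] (S : Finset Γ)
    (hsym : ∀ s ∈ S, s⁻¹ ∈ S)
    (hgen : Subgroup.closure (S : Set Γ) = ⊤)
    (f : ℝ → ℝ) (hf : IsControlFun f)
    (hvan : ∃ ψ : Γ → Γ → ℝ, IsChainW (S : Set Γ) f ψ ∧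
      ∀ x : Γ, ∑ᶠ y : Γ, ψ y x = 1)
    (ε : ℝ) (hε : 0 < ε)
    (hprof : ∀ r : ℕ, 1 ≤ r → ∃ A : Finset Γ, A.Nonempty ∧
      radW (S : Set Γ) A ≤ r ∧
      ε * (r : ℝ) * ((isoBdryW (S : Set Γ) (A : Set Γ)).ncard : ℝ) ≤ (A.card : ℝ)) :
    ∃ c > (0:ℝ), ∀ r : ℝ, 1 ≤ r → c * r ≤ f r := by
  obtain ⟨ψ, ⟨hanti, ⟨R, -, hR⟩, ⟨K, hK, hbound⟩⟩, hone⟩ := hvan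
  have hsym' : ∀ s ∈ (S : Set Γ), s⁻¹ ∈ (S : Set Γ) := hsym
  set N := ⌈R⌉₊ + 1
  obtain ⟨L, hL, hshift⟩ := hf.shift N (by positivity)
  set C : ℝ := ({b : Γ | wLen (S : Set Γ) b ≤ N}.ncard + 1) * N * (K * L)
  have hC : 0 < C := by positivity
  have hnat : ∀ r : ℕ, 1 ≤ r → ε * r ≤ C * f r := by
    intro r hr
    have hfr := hf.nonneg r (by positivity)
    obtain ⟨A, hA, hrad, hcard⟩ := hprof r hr
    obtain ⟨g, hg⟩ := exists_wDist_le_radW (S := (S : Set Γ)) A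
    have hiso := card_le_of_chain (N := N) (M := K * (L * f r)) S.finite_toSet hsym' hgen
      (ψ := fun x y => ψ (g⁻¹ * x) (g⁻¹ * y)) (fun _ _ => hanti _ _) ?_ ?_ A
      (by positivity) ?_
    · set n := (isoBdryW (S : Set Γ) (A : Set Γ)).ncard
      have hApos : (0 : ℝ) < A.card := by exact_mod_cast hA.card_pos
      have hle : (A.card : ℝ) ≤ C * f r * n := by
        refine hiso.trans (mul_le_mul_of_nonneg_right ?_ (by positivity))
        calc _ = {b : Γ | wLen (S : Set Γ) b ≤ N}.ncard * (N * (K * L) * f r) := by ring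
          _ ≤ ({b : Γ | wLen (S : Set Γ) b ≤ N}.ncard + 1) * (N * (K * L) * f r) := by
            gcongr
            linarith
          _ = _ := by ring
      have hn : (0 : ℝ) < n := by
        refine lt_of_le_of_ne (by positivity) fun h => ?_
        rw [← h, mul_zero] at hle
        linarith
      exact le_of_mul_le_mul_right (hcard.trans hle) hn
    · intro x y hxy
      refine hR _ _ ((Nat.le_ceil R).trans_lt ?_)
      have : wDist (S : Set Γ) (g⁻¹ * x) (g⁻¹ * y) = wDist (S : Set Γ) x y := by
        simp [wDist, mul_assoc]
      rw [this]
      exact_mod_cast (Nat.lt_succ_self _).trans hxy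
    · intro x
      rw [← hone (g⁻¹ * x)]
      exact finsum_comp_equiv (Equiv.mulLeft g⁻¹) (f := fun y => ψ y (g⁻¹ * x))
    · intro x hx y hxy
      have hxr : wLen (S : Set Γ) (g⁻¹ * x) ≤ r := (hg x hx).trans hrad
      have hyr : wLen (S : Set Γ) (g⁻¹ * y) ≤ r + N := by
        have h := wLen_mul_le hsym' hgen (g⁻¹ * x) (x⁻¹ * y)
        rw [mul_assoc, mul_inv_cancel_left] at h
        exact h.trans (Nat.add_le_add hxr hxy)
      refine (hbound _ _).trans (mul_le_mul_of_nonneg_left ?_ hK.le)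
      refine (hf.mono _ (r + N) (by positivity) (max_le ?_ ?_)).trans
        (hshift r (by exact_mod_cast hr))
      · exact_mod_cast hxr.trans (Nat.le_add_right r N)
      · exact_mod_cast hyr
  refine ⟨ε / (2 * C), by positivity, fun r hr => ?_⟩
  have hfloor : 1 ≤ ⌊r⌋₊ := Nat.one_le_floor_iff r |>.mpr hr
  have hlt := Nat.lt_floor_add_one r
  have hfloor' : (1 : ℝ) ≤ ⌊r⌋₊ := by exact_mod_cast hfloor
  have hmono := hf.mono ⌊r⌋₊ r (by positivity) (Nat.floor_le (by linarith))
  rw [div_mul_eq_mul_div, div_le_iff₀ (by positivity)]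
  have h1 := hnat _ hfloor
  have h2 := mul_le_mul_of_nonneg_left hmono hC.le
  have h3 : ε * r ≤ ε * (2 * ⌊r⌋₊) := mul_le_mul_of_nonneg_left (by linarith) hε.le
  linarith
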